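/- arXiv:2112.06828 — 3 statements merged into one kernel-verified Lean document; each statement's English description precedes it below -/
import Mathlib

section
/- Let α be an ordinal, regarded as the linearly ordered set of ordinals strictly below α, and equip it with the Alexandroff topology of its order (open sets are exactly the upward-closed sets). Then this space is Noetherian, its stature is α, and its sobrification rank is α if α is finite and α + 1 if α is infinite. -/
open TopologicalSpace

/-- The ordinal rank of an element of a poset: defined by well-founded recursion as the least
ordinal strictly greater than the ranks of all strictly smaller elements (and `0` as a junk
value if the strict order is not well-founded). -/
noncomputable def wfRank {α : Type*} [Preorder α] (a : α) : Ordinal :=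
  open Classical in
  if h : WellFoundedLT α then @IsWellFounded.rank α (· < ·) h a else 0

/-- The ordinal rank of a poset: the least ordinal strictly greater than the ranks of
all its elements. -/
noncomputable def ordRank (α : Type*) [Preorder α] : Ordinal :=
  ⨆ a : α, wfRank a + 1

/-- The stature of a topological space: the rank of the whole space in the poset of
closed subsets ordered by inclusion (equivalently, the ordinal rank of the poset of proper
closed subsets). -/
noncomputable def stature (X : Type*) [TopologicalSpace X] : Ordinal :=
  wfRank (⊤ : Closeds X)

/-- The sobrification rank of a topological space: the ordinal rank of the poset of
irreducible closed subsets ordered by inclusion. -/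
noncomputable def sobRank (X : Type*) [TopologicalSpace X] : Ordinal :=
  ordRank (IrreducibleCloseds X)

open Topology in
/-- The initial segment of points strictly below `b`. -/
def initialSegment (a b : Ordinal.{u}) : Set (WithUpperSet (Set.Iio a)) :=
  {x | (WithUpperSet.ofUpperSet x).1 < b}

/-- The least strict upper bound of a set of points. -/
noncomputable def strictSup {a : Ordinal.{u}} (S : Set (Topology.WithUpperSet (Set.Iio a))) :
    Ordinal.{u} :=
  sInf {b | S ⊆ initialSegment a b}

theorem wfRank_eq_of_strictMono {P : Type v} [Preorder P] (f : P → Ordinal.{v})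
    (hf : StrictMono f) (hsurj : ∀ p, ∀ o < f p, ∃ q < p, f q = o) (p : P) :
    wfRank p = f p := by
  have hwf : WellFoundedLT P := hf.wellFoundedLT
  rw [wfRank, dif_pos hwf]
  induction p using hwf.induction with
  | ind p ih =>
    rw [IsWellFounded.rank_eq]
    apply le_antisymm
    · refine Ordinal.iSup_le fun q => ?_
      rw [ih q.1 q.2, Order.succ_le_iff]
      exact hf q.2
    · refine le_of_forall_lt fun o ho => ?_
      obtain ⟨q, hq, rfl⟩ := hsurj p o ho
      rw [← ih q hq]
      exact (Order.lt_succ _).trans_le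
        (Ordinal.le_iSup (fun b : {b // b < p} => Order.succ (IsWellFounded.rank (· < ·) b.1))
          ⟨q, hq⟩)

section Segments

open Topology

variable {a b c : Ordinal.{u}} {S T : Set (WithUpperSet (Set.Iio a))}

theorem mem_initialSegment {x : WithUpperSet (Set.Iio a)} :
    x ∈ initialSegment a b ↔ (WithUpperSet.ofUpperSet x).1 < b :=
  Iff.rfl

theorem initialSegment_self : initialSegment a a = Set.univ :=
  Set.eq_univ_of_forall fun x => (WithUpperSet.ofUpperSet x).2

theorem initialSegment_mono (h : b ≤ c) : initialSegment a b ⊆ initialSegment a c :=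
  fun _ hx => lt_of_lt_of_le hx h

theorem isClosed_initialSegment : IsClosed (initialSegment a b) :=
  IsUpperSet.isClosed_iff_isLower.2 fun x y hyx hx =>
    lt_of_le_of_lt (show (WithUpperSet.ofUpperSet y).1 ≤ (WithUpperSet.ofUpperSet x).1 from hyx) hx

theorem subset_initialSegment_strictSup : S ⊆ initialSegment a (strictSup S) :=
  csInf_mem (s := {b | S ⊆ initialSegment a b})
    ⟨a, show S ⊆ initialSegment a a by rw [initialSegment_self]; exact Set.subset_univ S⟩

theorem strictSup_le (h : S ⊆ initialSegment a b) : strictSup S ≤ b :=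
  csInf_le' h

theorem strictSup_le_self : strictSup S ≤ a :=
  strictSup_le (by rw [initialSegment_self]; exact Set.subset_univ S)

theorem initialSegment_strictSup (hS : IsClosed S) : initialSegment a (strictSup S) = S := by
  refine (Set.Subset.antisymm fun x hx => ?_) subset_initialSegment_strictSup
  by_contra hxS
  refine (not_le_of_gt hx) (strictSup_le fun y hy => ?_)
  refine mem_initialSegment.2 (lt_of_not_ge fun hxy => hxS ?_)
  exact IsUpperSet.isClosed_iff_isLower.1 hS hxy hy

theorem strictSup_initialSegment (h : b ≤ a) : strictSup (initialSegment a b) = b := by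
  refine (strictSup_le subset_rfl).antisymm (le_of_not_gt fun hlt => ?_)
  have hmem : WithUpperSet.toUpperSet ⟨strictSup (initialSegment a b), hlt.trans_le h⟩ ∈
      initialSegment a b := hlt
  exact lt_irrefl _ (mem_initialSegment.1 (subset_initialSegment_strictSup hmem))

theorem strictSup_lt_strictSup (hT : IsClosed T) (hS : IsClosed S) (h : S ⊂ T) :
    strictSup S < strictSup T := by
  refine lt_of_not_ge fun hle => h.2 ?_
  rw [← initialSegment_strictSup hS, ← initialSegment_strictSup hT]
  exact initialSegment_mono hle

theorem one_le_strictSup (h : S.Nonempty) : 1 ≤ strictSup S := by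
  obtain ⟨x, hx⟩ := h
  exact Order.one_le_iff_pos.2
    (pos_of_gt (mem_initialSegment.1 (subset_initialSegment_strictSup hx)))

theorem isIrreducible_initialSegment (hb : 0 < b) (hba : b ≤ a) :
    IsIrreducible (initialSegment a b) := by
  refine ⟨⟨WithUpperSet.toUpperSet ⟨0, hb.trans_le hba⟩, hb⟩, ?_⟩
  rintro U V hU hV ⟨x, hx, hxU⟩ ⟨y, hy, hyV⟩
  rw [IsUpperSet.isOpen_iff_isUpperSet] at hU hV
  rcases le_total (WithUpperSet.ofUpperSet x) (WithUpperSet.ofUpperSet y) with h | h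
  · exact ⟨y, hy, hU h hxU, hyV⟩
  · exact ⟨x, hx, hxU, hV h hyV⟩

theorem strictMono_strictSup_closeds :
    StrictMono fun C : Closeds (WithUpperSet (Set.Iio a)) =>
      Ordinal.lift.{u + 1} (strictSup (C : Set (WithUpperSet (Set.Iio a)))) :=
  fun C D h => Ordinal.lift_lt.2 (strictSup_lt_strictSup D.isClosed C.isClosed h)

theorem wfRank_closeds (C : Closeds (WithUpperSet (Set.Iio a))) :
    wfRank C = Ordinal.lift.{u + 1} (strictSup (C : Set (WithUpperSet (Set.Iio a)))) := by
  refine wfRank_eq_of_strictMono _ strictMono_strictSup_closeds (fun D o ho => ?_) C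
  obtain ⟨b, rfl⟩ := Ordinal.mem_range_lift_of_le ho.le
  have hb := Ordinal.lift_lt.1 ho
  have hs := strictSup_initialSegment (hb.le.trans strictSup_le_self)
  refine ⟨⟨initialSegment a b, isClosed_initialSegment⟩, ?_, congrArg Ordinal.lift hs⟩
  refine lt_of_le_of_ne ?_ ?_
  · change initialSegment a b ⊆ (D : Set _)
    rw [← initialSegment_strictSup D.isClosed]
    exact initialSegment_mono hb.le
  · rintro rfl
    exact hb.ne hs.symm

theorem wfRank_irreducibleCloseds (C : IrreducibleCloseds (WithUpperSet (Set.Iio a))) :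
    wfRank C = Ordinal.lift.{u + 1} (strictSup (C : Set (WithUpperSet (Set.Iio a))) - 1) := by
  refine wfRank_eq_of_strictMono (fun C : IrreducibleCloseds (WithUpperSet (Set.Iio a)) =>
    Ordinal.lift.{u + 1} (strictSup (C : Set (WithUpperSet (Set.Iio a))) - 1))
    (fun D E h => ?_) (fun D o ho => ?_) C
  · rw [Ordinal.lift_lt, ← add_lt_add_iff_left 1,
      Ordinal.add_sub_cancel_of_le (one_le_strictSup D.isIrreducible.nonempty),
      Ordinal.add_sub_cancel_of_le (one_le_strictSup E.isIrreducible.nonempty)]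
    exact strictSup_lt_strictSup E.isClosed D.isClosed h
  · obtain ⟨b, rfl⟩ := Ordinal.mem_range_lift_of_le ho.le
    have hb := Ordinal.lift_lt.1 ho
    rw [← add_lt_add_iff_left 1,
      Ordinal.add_sub_cancel_of_le (one_le_strictSup D.isIrreducible.nonempty)] at hb
    have hba := hb.le.trans strictSup_le_self
    have hs := strictSup_initialSegment hba
    refine ⟨⟨initialSegment a (1 + b),
      isIrreducible_initialSegment (zero_lt_one.trans_le le_self_add) hba,
      isClosed_initialSegment⟩, ?_, ?_⟩
    · refine lt_of_le_of_ne ?_ ?_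
      · change initialSegment a (1 + b) ⊆ (D : Set _)
        rw [← initialSegment_strictSup D.isClosed]
        exact initialSegment_mono hb.le
      · rintro rfl
        exact hb.ne hs.symm
    · change Ordinal.lift.{u + 1} (strictSup (initialSegment a (1 + b)) - 1) = _
      rw [hs, Ordinal.add_sub_cancel]

theorem lift_sub_one_add_one_le_sobRank (ha : 0 < a) :
    Ordinal.lift.{u + 1} (a - 1) + 1 ≤ sobRank (WithUpperSet (Set.Iio a)) := by
  let C : IrreducibleCloseds (WithUpperSet (Set.Iio a)) :=
    ⟨initialSegment a a, isIrreducible_initialSegment ha le_rfl, isClosed_initialSegment⟩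
  have hC : wfRank C = Ordinal.lift.{u + 1} (a - 1) := by
    rw [wfRank_irreducibleCloseds]
    change Ordinal.lift.{u + 1} (strictSup (initialSegment a a) - 1) = _
    rw [strictSup_initialSegment le_rfl]
  rw [← hC]
  exact Ordinal.le_iSup (fun D : IrreducibleCloseds (WithUpperSet (Set.Iio a)) => wfRank D + 1) C

theorem sobRank_le {o : Ordinal.{u + 1}}
    (h : ∀ b, 0 < b → b ≤ a → Ordinal.lift.{u + 1} (b - 1) + 1 ≤ o) :
    sobRank (WithUpperSet (Set.Iio a)) ≤ o := by
  refine Ordinal.iSup_le fun C => ?_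
  rw [wfRank_irreducibleCloseds]
  exact h _ (zero_lt_one.trans_le (one_le_strictSup C.isIrreducible.nonempty)) strictSup_le_self

end Segments

theorem Ordinal.sub_one_add_one_of_lt_omega0 {b : Ordinal.{u}} (hb : 0 < b)
    (hb' : b < Ordinal.omega0) : b - 1 + 1 = b := by
  obtain ⟨n, rfl⟩ := Ordinal.lt_omega0.1 hb'
  obtain ⟨m, rfl⟩ := Nat.exists_eq_succ_of_ne_zero (n := n) (by rintro rfl; simp at hb)
  rw [← Nat.cast_one, ← Ordinal.natCast_sub, ← Nat.cast_add]
  simp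

/-- Let `a` be an ordinal, regarded as the linearly ordered set `Iio a` of ordinals strictly
below `a`, with the Alexandroff topology of its order (opens = upward-closed sets, i.e. the
upper set topology). This space is Noetherian, its stature is `a`, and its sobrification
rank is `a` if `a` is finite and `a + 1` if `a` is infinite. -/
theorem stature_sobRank_ordinal_alexandroff (a : Ordinal.{u}) :
    NoetherianSpace (Topology.WithUpperSet ↥(Set.Iio a)) ∧
    stature (Topology.WithUpperSet ↥(Set.Iio a)) = Ordinal.lift.{u + 1} a ∧
    (a < Ordinal.omega0 →
      sobRank (Topology.WithUpperSet ↥(Set.Iio a)) = Ordinal.lift.{u + 1} a) ∧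
    (Ordinal.omega0 ≤ a →
      sobRank (Topology.WithUpperSet ↥(Set.Iio a)) = Ordinal.lift.{u + 1} a + 1) := by
  refine ⟨?_, ?_, fun ha => ?_, fun ha => ?_⟩
  · exact ((noetherianSpace_TFAE _).out 0 1).2 strictMono_strictSup_closeds.wellFoundedLT
  · rw [stature, wfRank_closeds, Closeds.coe_top, ← initialSegment_self,
      strictSup_initialSegment le_rfl]
  · have key : ∀ b : Ordinal.{u}, 0 < b → b ≤ a →
        Ordinal.lift.{u + 1} (b - 1) + 1 = Ordinal.lift.{u + 1} b := fun b hb hba => by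
      rw [← Ordinal.lift_one.{u, u + 1}, ← Ordinal.lift_add,
        Ordinal.sub_one_add_one_of_lt_omega0 hb (hba.trans_lt ha)]
    apply le_antisymm
    · exact sobRank_le fun b hb hba => (key b hb hba).trans_le (Ordinal.lift_le.2 hba)
    · rcases eq_zero_or_pos a with rfl | hpos
      · simp
      · exact (key a hpos le_rfl).ge.trans (lift_sub_one_add_one_le_sobRank hpos)
  · apply le_antisymm
    · refine sobRank_le fun b _ hba => ?_
      gcongr
      exact Ordinal.lift_le.2 ((Ordinal.sub_le_self b 1).trans hba)
    · have h := lift_sub_one_add_one_le_sobRank (Ordinal.omega0_pos.trans_le ha)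
      have h1 : a - 1 = a := by
        conv_lhs => rw [← Ordinal.one_add_of_omega0_le ha]
        exact Ordinal.add_sub_cancel 1 a
      rwa [h1] at h
end

section
/- For every nonempty second-countable Noetherian space X, the chain length of the poset of closed subsets of X equals ||X|| + 1, and there is a chain in this poset whose length attains this supremum. -/
open TopologicalSpace

/-- The chain length of a poset: the supremum of the ordinal ranks (lengths) of its nonempty
totally ordered subsets. -/
noncomputable def chainLength (P : Type*) [Preorder P] : Ordinal :=
  ⨆ D : { D : Set P // D.Nonempty ∧ IsChain (· ≤ ·) D }, ordRank ↥(D.val)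

open Ordinal Set

namespace Ordinal

/-- The natural (Hessenberg) sum: the least ordinal-valued function that is strictly monotone in
both arguments. -/
noncomputable def naturalSum (a b : Ordinal.{u}) : Ordinal.{u} :=
  max (⨆ x : Iio a, naturalSum x.1 b + 1) (⨆ x : Iio b, naturalSum a x.1 + 1)
termination_by (a, b)
decreasing_by exacts [Prod.Lex.left _ _ x.2, Prod.Lex.right _ x.2]

theorem naturalSum_lt_of_lt_left {a a' : Ordinal} (h : a' < a) (b : Ordinal) :
    naturalSum a' b < naturalSum a b := by
  rw [naturalSum.eq_1 a]
  refine lt_max_of_lt_left ((lt_add_one _).trans_le ?_)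
  exact Ordinal.le_iSup (fun x : Iio a => naturalSum x.1 b + 1) ⟨a', h⟩

theorem naturalSum_lt_of_lt_right (a : Ordinal) {b b' : Ordinal} (h : b' < b) :
    naturalSum a b' < naturalSum a b := by
  rw [naturalSum.eq_1 a b]
  refine lt_max_of_lt_right ((lt_add_one _).trans_le ?_)
  exact Ordinal.le_iSup (fun x : Iio b => naturalSum a x.1 + 1) ⟨b', h⟩

theorem naturalSum_le_iff {a b c : Ordinal} :
    naturalSum a b ≤ c ↔ (∀ a' < a, naturalSum a' b < c) ∧ ∀ b' < b, naturalSum a b' < c := by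
  refine ⟨fun h => ⟨fun a' ha => (naturalSum_lt_of_lt_left ha b).trans_le h,
    fun b' hb => (naturalSum_lt_of_lt_right a hb).trans_le h⟩, fun h => ?_⟩
  rw [naturalSum]
  refine max_le (Ordinal.iSup_le fun x => ?_) (Ordinal.iSup_le fun x => ?_)
  · exact Order.add_one_le_of_lt (h.1 _ x.2)
  · exact Order.add_one_le_of_lt (h.2 _ x.2)

theorem naturalSum_lt_naturalSum {a a' b b' : Ordinal} (ha : a' ≤ a) (hb : b' ≤ b)
    (h : a' < a ∨ b' < b) : naturalSum a' b' < naturalSum a b := by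
  rcases ha.eq_or_lt with rfl | ha
  · exact naturalSum_lt_of_lt_right _ (h.resolve_left (lt_irrefl _))
  · refine (naturalSum_lt_of_lt_left ha b').trans_le ?_
    rcases hb.eq_or_lt with rfl | hb
    · exact le_rfl
    · exact (naturalSum_lt_of_lt_right a hb).le

private theorem div_mod_lex {r x' x : Ordinal} (h : x' < x) :
    x' / r < x / r ∨ x' / r = x / r ∧ x' % r < x % r := by
  rcases (div_le_left h.le r).lt_or_eq with h' | h'
  · exact .inl h'
  · refine .inr ⟨h', ?_⟩
    rw [← div_add_mod x' r, ← div_add_mod x r, h'] at h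
    exact lt_of_add_lt_add_left h

/-- If `r` is closed under natural sums, the natural sum of `x` and `y` can be bounded by adding
quotients and remainders modulo `r` separately, provided the quotient of `y` is finite. -/
theorem naturalSum_le_mul_add {r : Ordinal} (hr0 : r ≠ 0)
    (hr : ∀ x < r, ∀ y < r, naturalSum x y < r) (x y : Ordinal) (hy : y / r < ω) :
    naturalSum x y ≤ r * (x / r + y / r) + naturalSum (x % r) (y % r) := by
  have key : ∀ {p q u v : Ordinal} (c : Ordinal), p < q → u < r → v < r →
      r * p + naturalSum u v < r * q + c := fun {p q u v} c h hu hv => calc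
    r * p + naturalSum u v < r * p + r := by simpa using hr u hu v hv
    _ = r * (p + 1) := by rw [mul_add, mul_one]
    _ ≤ r * q := mul_le_mul_right (Order.add_one_le_of_lt h) r
    _ ≤ _ := le_self_add
  refine naturalSum_le_iff.2 ⟨fun x' h => ?_, fun y' h => ?_⟩
  · refine (naturalSum_le_mul_add hr0 hr x' y hy).trans_lt ?_
    rcases div_mod_lex (r := r) h with h' | ⟨h', h''⟩
    · refine key _ ?_ (mod_lt _ hr0) (mod_lt _ hr0)
      obtain ⟨n, hn⟩ := lt_omega0.1 hy
      rw [hn]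
      exact lt_iff_lt_of_le_iff_le (Ordinal.add_le_add_iff_right n) |>.2 h'
    · rw [h']
      simpa using naturalSum_lt_of_lt_left h'' _
  · refine (naturalSum_le_mul_add hr0 hr x y' ((div_le_left h.le r).trans_lt hy)).trans_lt ?_
    rcases div_mod_lex (r := r) h with h' | ⟨h', h''⟩
    · exact key _ (by simpa using h') (mod_lt _ hr0) (mod_lt _ hr0)
    · rw [h']
      simpa using naturalSum_lt_of_lt_right _ h''
termination_by (x, y)

theorem naturalSum_lt_omega0_opow (e : Ordinal) :
    ∀ x < ω ^ e, ∀ y < ω ^ e, naturalSum x y < ω ^ e := by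
  induction e using limitRecOn with
  | zero =>
    intro x hx y hy
    simp only [opow_zero, Order.lt_one_iff] at hx hy ⊢
    subst hx hy
    rw [← nonpos_iff_eq_zero, naturalSum_le_iff]
    simp
  | add_one e ih =>
    intro x hx y hy
    have h0 : ω ^ e ≠ 0 := opow_ne_zero _ omega0_ne_zero
    rw [opow_add_one] at hx hy ⊢
    have hx' := (lt_mul_iff_div_lt h0).1 hx
    have hy' := (lt_mul_iff_div_lt h0).1 hy
    refine (naturalSum_le_mul_add h0 ih x y hy').trans_lt ?_
    calc
      _ < ω ^ e * (x / ω ^ e + y / ω ^ e) + ω ^ e := by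
        simpa using ih _ (mod_lt _ h0) _ (mod_lt _ h0)
      _ = ω ^ e * (x / ω ^ e + y / ω ^ e + 1) := by rw [mul_add _ _ 1, mul_one]
      _ ≤ ω ^ e * ω := mul_le_mul_right (Order.add_one_le_of_lt
        (isPrincipal_add_omega0 hx' hy')) _
  | limit e he ih =>
    intro x hx y hy
    obtain ⟨c, hc, hxc⟩ := (lt_opow_of_isSuccLimit omega0_ne_zero he).1 hx
    obtain ⟨d, hd, hyd⟩ := (lt_opow_of_isSuccLimit omega0_ne_zero he).1 hy
    have hm : max c d < e := max_lt hc hd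
    refine (ih _ hm x (hxc.trans_le ?_) y (hyd.trans_le ?_)).trans_le ?_
    · exact opow_le_opow_right omega0_pos (le_max_left _ _)
    · exact opow_le_opow_right omega0_pos (le_max_right _ _)
    · exact opow_le_opow_right omega0_pos hm.le

theorem naturalSum_lt_omega0_opow_mul {e m x y : Ordinal} (hx : x < ω ^ e * (m + 1))
    (hy : y < ω ^ e) : naturalSum x y < ω ^ e * (m + 1) := by
  have h0 : ω ^ e ≠ 0 := opow_ne_zero _ omega0_ne_zero
  have hr := naturalSum_lt_omega0_opow e
  have hy0 : y / ω ^ e = 0 := div_eq_zero_of_lt hy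
  refine (naturalSum_le_mul_add h0 hr x y (by simp [hy0])).trans_lt ?_
  have hxm := (lt_mul_iff_div_lt h0).1 hx
  calc
    _ < ω ^ e * (x / ω ^ e) + ω ^ e := by
      rw [hy0, add_zero]
      simpa using hr _ (mod_lt _ h0) _ (mod_lt _ h0)
    _ = ω ^ e * (x / ω ^ e + 1) := by rw [mul_add _ _ 1, mul_one]
    _ ≤ _ := mul_le_mul_right (Order.add_one_le_of_lt hxm) _

theorem exists_eq_omega0_opow_mul_add_one (a : Ordinal) (ha : a ≠ 0) :
    ∃ e m : Ordinal, a = ω ^ e * (m + 1) := by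
  induction a using WellFoundedLT.induction with | _ a ih
  set g := log ω a
  have hd := div_add_mod a (ω ^ g)
  by_cases hr : a % ω ^ g = 0
  · obtain ⟨n, hn⟩ := lt_omega0.1 (div_opow_log_lt a one_lt_omega0)
    have hpos := div_opow_log_pos ω ha
    rw [hn] at hpos
    obtain ⟨k, rfl⟩ := Nat.exists_eq_succ_of_ne_zero (n := n) (by rintro rfl; simp at hpos)
    refine ⟨g, k, ?_⟩
    rw [hr, add_zero, hn] at hd
    simpa using hd.symm
  · obtain ⟨e, m, hem⟩ := ih _ (mod_opow_log_lt_self ω ha) hr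
    have heg : e ≤ g := by
      rw [← opow_le_opow_iff_right one_lt_omega0]
      refine le_trans ?_ (mod_lt a (opow_ne_zero g omega0_ne_zero)).le
      rw [hem]
      exact le_mul_of_one_le_right' (by simp)
    refine ⟨e, ω ^ (g - e) * (a / ω ^ g) + m, ?_⟩
    rw [add_assoc, mul_add, ← hem, ← mul_assoc, ← opow_add, Ordinal.add_sub_cancel_of_le heg, hd]

end Ordinal

section RelativeRank

variable {P : Type*} [PartialOrder P] [WellFoundedLT P]

private theorem wellFounded_le_and_lt (A : P) : IsWellFounded P fun x y => A ≤ x ∧ x < y :=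
  ⟨Subrelation.wf (fun h => h.2) (wellFounded_lt (α := P))⟩

/-- The rank of `B` in the poset of elements above `A`. -/
noncomputable def relRank (A B : P) : Ordinal :=
  @IsWellFounded.rank P (fun x y => A ≤ x ∧ x < y) (wellFounded_le_and_lt A) B

theorem relRank_lt {A B C : P} (hA : A ≤ B) (h : B < C) : relRank A B < relRank A C :=
  @IsWellFounded.rank_lt_of_rel P _ _ _ (wellFounded_le_and_lt A) ⟨hA, h⟩

theorem relRank_le {A B : P} {o : Ordinal} (h : ∀ C, A ≤ C → C < B → relRank A C < o) :
    relRank A B ≤ o := by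
  rw [relRank, @IsWellFounded.rank_eq P _ (wellFounded_le_and_lt A)]
  exact Ordinal.iSup_le fun C => Order.succ_le_of_lt (h C C.2.1 C.2.2)

theorem exists_relRank_eq {A B : P} {o : Ordinal} (h : o < relRank A B) :
    ∃ C, A ≤ C ∧ C < B ∧ relRank A C = o := by
  induction B using WellFoundedLT.induction with | _ B ih
  by_contra! hne
  refine h.not_ge (relRank_le fun C hA hC => ?_)
  by_contra! hle
  rcases hle.eq_or_lt with h' | h'
  · exact hne C hA hC h'.symm
  · obtain ⟨D, hD, hDC, rfl⟩ := ih C hC h'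
    exact hne D hD (hDC.trans hC) rfl

theorem relRank_bot [OrderBot P] (B : P) : relRank ⊥ B = wfRank B := by
  have hw : WellFoundedLT P := inferInstance
  rw [relRank, wfRank, dif_pos hw]
  congr! 2
  simp

theorem countable_Iio_relRank [Countable P] (A B : P) : (Iio (relRank A B)).Countable :=
  (countable_range (relRank A)).mono fun _ h => (exists_relRank_eq h).imp fun _ hC => hC.2.2

end RelativeRank

section LongChain

variable {P : Type*} [PartialOrder P]

/-- The interval `[A, B]` contains a chain of length `a + 1`. -/
def HasLongChain (A B : P) (a : Ordinal) : Prop :=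
  ∃ f : Ordinal → P, StrictMonoOn f (Iic a) ∧ ∀ x ≤ a, f x ∈ Icc A B

theorem HasLongChain.add {A B C : P} {a b : Ordinal} (h₁ : HasLongChain A C a)
    (h₂ : HasLongChain C B b) : HasLongChain A B (a + b) := by
  obtain ⟨f, hf, hfI⟩ := h₁
  obtain ⟨g, hg, hgI⟩ := h₂
  have hsub {x : Ordinal} (hx : x ≤ a + b) : x - a ≤ b := sub_le.2 hx
  have hAC : A ≤ C := (hfI 0 zero_le).1.trans (hfI 0 zero_le).2
  have hCB : C ≤ B := (hgI 0 zero_le).1.trans (hgI 0 zero_le).2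
  refine ⟨fun x => if x ≤ a then f x else g (x - a), fun x hx y hy hxy => ?_, fun x hx => ?_⟩
  · dsimp only
    split_ifs with h h' h'
    · exact hf h h' hxy
    · refine (hfI x h).2.trans_lt ((hgI 0 zero_le).1.trans_lt ?_)
      exact hg (mem_Iic.2 zero_le) (hsub hy)
        (pos_iff_ne_zero.2 (Ordinal.sub_ne_zero_iff_lt.2 (not_le.1 h')))
    · exact absurd (hxy.le.trans h') h
    · refine hg (hsub hx) (hsub hy) (lt_sub.2 ?_)
      rwa [Ordinal.add_sub_cancel_of_le (not_le.1 h).le]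
  · dsimp only
    split_ifs with h
    · exact ⟨(hfI x h).1, (hfI x h).2.trans hCB⟩
    · exact ⟨hAC.trans (hgI _ (hsub hx)).1, (hgI _ (hsub hx)).2⟩

theorem hasLongChain_of_monotone {A B : P} {a : Ordinal} {c : ℕ → Ordinal} (hc : range c = Iio a)
    {C : ℕ → P} (hC : Monotone C) (hA : A ≤ C 0) (hB : ∀ n, C n < B)
    (h : ∀ n, HasLongChain (C n) (C (n + 1)) (c n)) : HasLongChain A B a := by
  classical
  choose f hf hfI using h
  have hex (x : Ordinal) (hx : x < a) : ∃ n, x ≤ c n := by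
    obtain ⟨n, rfl⟩ := hc.ge hx
    exact ⟨n, le_rfl⟩
  have hAC (n : ℕ) : A ≤ C n := hA.trans (hC n.zero_le)
  refine ⟨fun x => if hx : x < a then f (Nat.find (hex x hx)) x else B,
    fun x hx y hy hxy => ?_, fun x hx => ?_⟩
  · have hxa : x < a := hxy.trans_le hy
    have hxn := Nat.find_spec (hex x hxa)
    dsimp only
    rw [dif_pos hxa]
    split_ifs with hya
    · have hyn := Nat.find_spec (hex y hya)
      have hle : Nat.find (hex x hxa) ≤ Nat.find (hex y hya) :=
        Nat.find_min' _ (hxy.le.trans hyn)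
      rcases hle.eq_or_lt with heq | hlt
      · rw [heq] at hxn ⊢
        exact hf _ hxn hyn hxy
      · refine ((hfI _ x hxn).2.trans (hC hlt)).trans_lt ?_
        exact (hfI _ 0 zero_le).1.trans_lt
          (hf _ (mem_Iic.2 zero_le) hyn (zero_le.trans_lt hxy))
    · exact (hfI _ x hxn).2.trans_lt (hB _)
  · dsimp only
    split_ifs with hxa
    · have hI := hfI _ x (Nat.find_spec (hex x hxa))
      exact ⟨(hAC _).trans hI.1, hI.2.trans (hB _).le⟩
    · exact ⟨(hAC 0).trans (hB 0).le, le_rfl⟩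

end LongChain

section ModularLattice

variable {P : Type*} [Lattice P] [IsModularLattice P] [WellFoundedLT P]

theorem relRank_le_naturalSum {A C : P} (hAC : A ≤ C) (F : P) :
    relRank A F ≤ naturalSum (relRank A (F ⊓ C)) (relRank C (F ⊔ C)) := by
  induction F using WellFoundedLT.induction with | _ F ih
  refine relRank_le fun E hAE hE => (ih E hE).trans_lt ?_
  have hinf : E ⊓ C ≤ F ⊓ C := inf_le_inf_right C hE.le
  have hsup : E ⊔ C ≤ F ⊔ C := sup_le_sup_right hE.le C
  have hA : A ≤ E ⊓ C := le_inf hAE hAC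
  have h1 : E ⊓ C = F ⊓ C ∨ E ⊓ C < F ⊓ C := hinf.eq_or_lt
  have h2 : E ⊔ C = F ⊔ C ∨ E ⊔ C < F ⊔ C := hsup.eq_or_lt
  refine naturalSum_lt_naturalSum ?_ ?_ ?_
  · rcases h1 with h | h
    · rw [h]
    · exact (relRank_lt hA h).le
  · rcases h2 with h | h
    · rw [h]
    · exact (relRank_lt le_sup_right h).le
  · rcases h1 with h1 | h1
    · rcases h2 with h2 | h2
      · exact absurd (eq_of_le_of_inf_le_of_sup_le hE.le h1.ge h2.ge) hE.ne
      · exact .inr (relRank_lt le_sup_right h2)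
    · exact .inl (relRank_lt hA h1)

theorem omega0_opow_le_relRank {A C B : P} (hAC : A ≤ C) (hCB : C ≤ B) {e m : Ordinal}
    (hC : relRank A C < ω ^ e * (m + 1)) (hB : ω ^ e * (m + 1) ≤ relRank A B) :
    ω ^ e ≤ relRank C B := by
  by_contra! h
  refine (naturalSum_lt_omega0_opow_mul hC h).not_ge (hB.trans ?_)
  simpa [inf_eq_right.2 hCB, sup_eq_left.2 hCB] using relRank_le_naturalSum hAC B

/-- In a countable well-founded modular lattice, every interval contains a chain whose length
witnesses the rank of the interval. -/
theorem hasLongChain_of_le_relRank [Countable P] (a : Ordinal) {A B : P} (hAB : A ≤ B)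
    (ha : a ≤ relRank A B) : HasLongChain A B a := by
  induction a using WellFoundedLT.induction generalizing A B with | _ a ih
  wlog hB : relRank A B = a generalizing B
  · obtain ⟨B', hA, hB', hr⟩ := exists_relRank_eq (ha.lt_of_ne' hB)
    obtain ⟨f, hf, hfI⟩ := this hA hr.ge hr
    exact ⟨f, hf, fun x hx => ⟨(hfI x hx).1, (hfI x hx).2.trans hB'.le⟩⟩
  by_cases ha0 : a = 0
  · subst ha0
    refine ⟨fun _ => A, fun x hx y hy hxy => ?_, fun _ _ => ⟨le_rfl, hAB⟩⟩
    exact absurd (hxy.trans_le hy) not_lt_zero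
  obtain ⟨e, m, rfl⟩ := exists_eq_omega0_opow_mul_add_one a ha0
  by_cases hm : m = 0
  · have hone : ω ^ e * (m + 1) = ω ^ e := by simp [hm]
    have hcount := countable_Iio_relRank A B
    rw [hB] at hcount
    obtain ⟨c, hc⟩ := hcount.exists_eq_range ⟨0, pos_iff_ne_zero.2 ha0⟩
    have hcn (n : ℕ) : c n < ω ^ e * (m + 1) := hc.ge ⟨n, rfl⟩
    have step (n : ℕ) (C : Ico A B) : ∃ D : Ico A B, C ≤ D ∧ relRank C.1 D.1 = c n := by
      have h := omega0_opow_le_relRank C.2.1 C.2.2.le ((relRank_lt C.2.1 C.2.2).trans_eq hB) ha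
      obtain ⟨D, hCD, hDB, hD⟩ := exists_relRank_eq ((hone ▸ hcn n).trans_le h)
      exact ⟨⟨D, C.2.1.trans hCD, hDB⟩, hCD, hD⟩
    choose s hs hsr using step
    have hlt : A < B := hAB.lt_of_ne fun h => by
      subst h
      exact ha0 (hB ▸ nonpos_iff_eq_zero.1 (relRank_le fun C hA hC => absurd hC hA.not_gt))
    let C : ℕ → Ico A B := Nat.rec ⟨A, le_rfl, hlt⟩ s
    refine hasLongChain_of_monotone (C := fun n => (C n).1) hc.symm
      (monotone_nat_of_le_succ fun n => hs n (C n)) le_rfl (fun n => (C n).2.2) fun n => ?_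
    exact ih _ (hcn n) (hs n (C n)) (hsr n (C n)).ge
  · have hpos : 0 < ω ^ e := opow_pos e omega0_pos
    have hlt : ω ^ e * m < ω ^ e * (m + 1) := by simp [mul_add, hpos]
    obtain ⟨C, hAC, hCB, hC⟩ := exists_relRank_eq (hB ▸ hlt)
    have h := omega0_opow_le_relRank hAC hCB.le (hC ▸ hlt) ha
    have hlt' : ω ^ e < ω ^ e * (m + 1) := by
      refine lt_mul_of_one_lt_right hpos ?_
      simpa [Order.one_le_iff_pos, pos_iff_ne_zero] using hm
    rw [mul_add, mul_one]
    exact (ih _ hlt hAC hC.ge).add (ih _ hlt' hCB.le h)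

end ModularLattice

section Chains

variable {P : Type*} [PartialOrder P] [WellFoundedLT P]

theorem wfRank_strictMono : StrictMono (wfRank : P → Ordinal) := fun a b h => by
  have hw : WellFoundedLT P := inferInstance
  simp only [wfRank, dif_pos hw]
  exact WellFoundedLT.rank_strictMono h

theorem wfRank_le {a : P} {o : Ordinal} (h : ∀ b < a, wfRank b < o) : wfRank a ≤ o := by
  have hw : WellFoundedLT P := inferInstance
  simp only [wfRank, dif_pos hw] at h ⊢
  rw [IsWellFounded.rank_eq]
  exact Ordinal.iSup_le fun b => Order.succ_le_of_lt (h b b.2)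

theorem wfRank_le_wfRank_coe {D : Set P} (d : D) : wfRank d ≤ wfRank (d : P) := by
  induction d using WellFoundedLT.induction with | _ d ih
  exact wfRank_le fun b hb => (ih b hb).trans_lt (wfRank_strictMono hb)

theorem ordRank_coe_le [OrderTop P] (D : Set P) : ordRank D ≤ wfRank (⊤ : P) + 1 :=
  Ordinal.iSup_le fun d => by
    gcongr
    exact (wfRank_le_wfRank_coe d).trans (wfRank_strictMono.monotone le_top)

theorem add_one_le_ordRank_image {a : Ordinal} {f : Ordinal → P} (hf : StrictMonoOn f (Iic a)) :
    a + 1 ≤ ordRank (f '' Iic a) := by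
  have key (x : Ordinal) (hx : x ≤ a) :
      x ≤ wfRank (⟨f x, mem_image_of_mem f hx⟩ : f '' Iic a) := by
    induction x using WellFoundedLT.induction with | _ x ih
    refine le_of_forall_lt fun y hy => (ih y hy (hy.le.trans hx)).trans_lt ?_
    exact wfRank_strictMono (hf (hy.le.trans hx) hx hy)
  refine (add_le_add_left (key a le_rfl) 1).trans ?_
  exact Ordinal.le_iSup (fun d : f '' Iic a => wfRank d + 1) _

end Chains

theorem TopologicalSpace.NoetherianSpace.countable_closeds (X : Type*) [TopologicalSpace X]
    [NoetherianSpace X] [SecondCountableTopology X] : Countable (Closeds X) := by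
  have hb := isBasis_countableBasis X
  have hex (C : Closeds X) :
      ∃ s : Finset (countableBasis X), (C : Set X)ᶜ = ⋃₀ (s : Set (countableBasis X)) :=
    eq_sUnion_finset_of_isTopologicalBasis_of_isCompact_open _ hb _
      (NoetherianSpace.isCompact _) C.2.isOpen_compl
  choose s hs using hex
  refine Function.Injective.countable (f := s) fun C D h => ?_
  exact Closeds.ext (compl_injective ((hs C).trans (h ▸ (hs D).symm)))

/-- For every nonempty second-countable Noetherian space `X`, the chain length of the poset
of closed subsets of `X` equals `‖X‖ + 1`, and some chain attains this supremum. -/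
theorem chainLength_closeds (X : Type u) [TopologicalSpace X] [NoetherianSpace X]
    [SecondCountableTopology X] [Nonempty X] :
    chainLength (Closeds X) = stature X + 1 ∧
    ∃ D : Set (Closeds X), D.Nonempty ∧ IsChain (· ≤ ·) D ∧ ordRank ↥D = stature X + 1 := by
  have := NoetherianSpace.countable_closeds X
  obtain ⟨f, hf, -⟩ := hasLongChain_of_le_relRank (stature X) (bot_le (a := (⊤ : Closeds X)))
    (relRank_bot _).ge
  have hne : (f '' Iic (stature X)).Nonempty := ⟨_, mem_image_of_mem f self_mem_Iic⟩
  have hchain : IsChain (· ≤ ·) (f '' Iic (stature X)) := by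
    rintro _ ⟨x, hx, rfl⟩ _ ⟨y, hy, rfl⟩ -
    exact (le_total x y).imp (hf.monotoneOn hx hy) (hf.monotoneOn hy hx)
  have hrank : ordRank (f '' Iic (stature X)) = stature X + 1 :=
    (ordRank_coe_le _).antisymm (add_one_le_ordRank_image hf)
  refine ⟨le_antisymm (Ordinal.iSup_le fun D => ordRank_coe_le D.1) (hrank.ge.trans ?_),
    _, hne, hchain, hrank⟩
  exact Ordinal.le_iSup (fun D : {D : Set (Closeds X) // D.Nonempty ∧ IsChain (· ≤ ·) D} =>
    ordRank D.1) ⟨_, hne, hchain⟩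
end

section
/- Let f : X → Y be a continuous map from a Noetherian space X to a topological space Y. If f is Skula dense, i.e. the preimage map F ↦ f⁻¹(F) from closed subsets of Y to closed subsets of X is injective, then Y is Noetherian and ||Y|| ≤ ||X||. -/
open TopologicalSpace

theorem wfRank_eq_rank {α : Type*} [Preorder α] [WellFoundedLT α] (a : α) :
    wfRank a = IsWellFounded.rank (α := α) (· < ·) a :=
  dif_pos _

/-- A strictly monotone map into a well-founded order does not decrease ranks. -/
theorem StrictMono.wfRank_le {α β : Type u} [Preorder α] [Preorder β] [WellFoundedLT β]
    {g : α → β} (hg : StrictMono g) (a : α) : wfRank a ≤ wfRank (g a) := by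
  have : WellFoundedLT α := hg.wellFoundedLT
  induction a using WellFoundedLT.induction with
  | ind a ih =>
    rw [wfRank_eq_rank, IsWellFounded.rank_eq]
    refine Ordinal.iSup_le fun b => Order.succ_le_of_lt ?_
    rw [← wfRank_eq_rank]
    refine (ih b b.2).trans_lt ?_
    rw [wfRank_eq_rank, wfRank_eq_rank]
    exact IsWellFounded.rank_lt_of_rel (hg b.2)

/-- If `f : X → Y` is a continuous map from a Noetherian space `X` which is Skula dense
(preimage is injective on closed sets), then `Y` is Noetherian and `‖Y‖ ≤ ‖X‖`. -/
theorem stature_le_of_skulaDense (X Y : Type u) [TopologicalSpace X] [TopologicalSpace Y]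
    [NoetherianSpace X] (f : X → Y) (hf : Continuous f)
    (hsk : ∀ F G : Set Y, IsClosed F → IsClosed G → f ⁻¹' F = f ⁻¹' G → F = G) :
    NoetherianSpace Y ∧ stature Y ≤ stature X := by
  let g : Closeds Y → Closeds X := fun F => F.preimage hf
  have hg : StrictMono g := by
    have hmono : Monotone g := fun F G h => Set.preimage_mono (f := f) h
    refine hmono.strictMono_of_injective fun F G h => Closeds.ext ?_
    exact hsk F G F.isClosed G.isClosed (congrArg SetLike.coe h)
  have htop : g ⊤ = ⊤ := Closeds.ext (Set.preimage_univ (f := f))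
  refine ⟨((noetherianSpace_TFAE Y).out 0 1).2 hg.wellFoundedLT, ?_⟩
  simpa only [stature, htop] using hg.wfRank_le ⊤
end
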